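/- Let f : {0,1}^n → {0,1} be symmetric, given by a predicate g : {0,..,n} → {0,1} via f(x) = g(|x|). Let S_f = {k : 1 ≤ k ≤ n, g(k) ≠ g(k-1)}. Then the adjacency matrix of the sensitivity graph of f equals the sum over k ∈ S_f of the adjacency matrices of the sensitivity graphs of the threshold functions T_k. -/

import Mathlib

open Finset

/-- Hamming weight of a Boolean string. -/
def wt {n : ℕ} (x : Fin n → Bool) : ℕ := (univ.filter (fun i => x i = true)).card

/-- The threshold function with threshold `k` on `n` bits. -/
def Tk (n k : ℕ) (x : Fin n → Bool) : Bool := decide (k ≤ wt x)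

/-- Flip the `i`-th bit of `x`. -/
def flipBit {n : ℕ} (x : Fin n → Bool) (i : Fin n) : Fin n → Bool := Function.update x i (!x i)

/-- Sensitivity of `f` at input `x`. -/
def sens {n : ℕ} (f : (Fin n → Bool) → Bool) (x : Fin n → Bool) : ℕ :=
  (univ.filter (fun i => f (flipBit x i) ≠ f x)).card

/-- Adjacency matrix of the sensitivity graph of `f`. -/
def adjMat {n : ℕ} (f : (Fin n → Bool) → Bool) : Matrix (Fin n → Bool) (Fin n → Bool) ℝ :=
  fun x y => if hammingDist x y = 1 ∧ f x ≠ f y then 1 else 0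

theorem wt_eq_add_one_of_forall_ne {n : ℕ} {x y : Fin n → Bool} {i : Fin n} (hx : x i = true)
    (hy : y i = false) (h : ∀ j, j ≠ i → x j = y j) : wt x = wt y + 1 := by
  have hins : univ.filter (fun j => x j = true) =
      insert i (univ.filter (fun j => y j = true)) := by
    ext j
    by_cases hj : j = i
    · simp [hj, hx]
    · simp [hj, h j hj]
  rw [wt, hins, card_insert_of_notMem (by simp [hy]), wt]

theorem wt_eq_add_one_or_of_hammingDist_eq_one {n : ℕ} {x y : Fin n → Bool}
    (h : hammingDist x y = 1) : wt x = wt y + 1 ∨ wt y = wt x + 1 := by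
  obtain ⟨i, hi⟩ := card_eq_one.mp h
  have key : ∀ j, x j ≠ y j ↔ j = i := fun j => by
    simpa using congrArg (j ∈ ·) hi
  have hne : ∀ j, j ≠ i → x j = y j := fun j hj => not_not.mp (mt (key j).mp hj)
  have hii := (key i).mpr rfl
  cases hx : x i
  · right
    exact wt_eq_add_one_of_forall_ne (by simpa [hx] using hii.symm) hx
      fun j hj => (hne j hj).symm
  · left
    exact wt_eq_add_one_of_forall_ne hx (by simpa [hx] using hii.symm) hne

theorem wt_le {n : ℕ} (x : Fin n → Bool) : wt x ≤ n := by
  simpa [wt] using card_filter_le (univ : Finset (Fin n)) (fun i => x i = true)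

theorem adjMat_comm {n : ℕ} (f : (Fin n → Bool) → Bool) (x y : Fin n → Bool) :
    adjMat f x y = adjMat f y x := by
  simp only [adjMat, hammingDist_comm x y, ne_comm (a := f x)]

theorem adjMat_Tk_of_wt_eq_add_one {n : ℕ} {x y : Fin n → Bool} (hd : hammingDist x y = 1)
    (hw : wt x = wt y + 1) (k : ℕ) : adjMat (Tk n k) x y = if k = wt x then 1 else 0 := by
  have hk : Tk n k x ≠ Tk n k y ↔ k = wt x := by
    simp only [Tk, ne_eq, decide_eq_decide]
    omega
  simp only [adjMat, hd, hk, true_and]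

theorem adjMat_apply_of_wt_eq_add_one {n : ℕ} {g : ℕ → Bool} {f : (Fin n → Bool) → Bool}
    (hf : ∀ x, f x = g (wt x)) {x y : Fin n → Bool} (hd : hammingDist x y = 1)
    (hw : wt x = wt y + 1) :
    adjMat f x y =
      ∑ k ∈ (Finset.Icc 1 n).filter (fun k => g k ≠ g (k - 1)), adjMat (Tk n k) x y := by
  have hle := wt_le x
  have h1 : 1 ≤ wt x := by omega
  have hsub : wt x - 1 = wt y := by omega
  simp only [adjMat_Tk_of_wt_eq_add_one hd hw, sum_ite_eq', mem_filter, mem_Icc, h1, hle, hsub,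
    true_and]
  simp only [adjMat, hd, hf, true_and]

theorem adjMat_symm_eq_sum_thresholds (n : ℕ) (g : ℕ → Bool) (f : (Fin n → Bool) → Bool)
    (hf : ∀ x, f x = g (wt x)) :
    adjMat f = ∑ k ∈ (Finset.Icc 1 n).filter (fun k => g k ≠ g (k - 1)), adjMat (Tk n k) := by
  ext x y
  rw [Matrix.sum_apply]
  by_cases hd : hammingDist x y = 1
  · rcases wt_eq_add_one_or_of_hammingDist_eq_one hd with hw | hw
    · exact adjMat_apply_of_wt_eq_add_one hf hd hw
    · simp only [adjMat_comm _ x y]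
      exact adjMat_apply_of_wt_eq_add_one hf (hammingDist_comm x y ▸ hd) hw
  · simp [adjMat, hd]
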